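/- Transfinite recursion: for any operation f assigning a value to each set, and for any well-ordered set a that is compatible with f (meaning each element x of a equals f applied to the set of strict predecessors of x in a), the elements of a are uniquely determined by their position; more precisely, if a and b are two well-ordered sets compatible with f, then one is an initial segment of the other, and the relation leq_gen f obtained as the union of the orders of all compatible well-ordered sets is itself a well-founded partial order. -/

import Mathlib

/-- A well-ordered set `(A, le)` of ZF-sets is compatible with the operation `f`
if `le` is a well-order on the members of `A` and every element `x` of `A` equals
`f` applied to the set of strict predecessors of `x` in `A` (the punctured downward
subset of `x`). -/
def IsCompatible (f : ZFSet → ZFSet) (A : ZFSet) (le : ZFSet → ZFSet → Prop) : Prop :=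
  (∀ x ∈ A, le x x) ∧
  (∀ x ∈ A, ∀ y ∈ A, le x y → le y x → x = y) ∧
  (∀ x ∈ A, ∀ y ∈ A, ∀ z ∈ A, le x y → le y z → le x z) ∧
  (∀ x ∈ A, ∀ y ∈ A, le x y ∨ le y x) ∧
  (∀ B : ZFSet, B ⊆ A → B.Nonempty → ∃ m ∈ B, ∀ y ∈ B, le m y) ∧
  (∀ x ∈ A, ∃ u : ZFSet, (∀ y : ZFSet, y ∈ u ↔ y ∈ A ∧ le y x ∧ y ≠ x) ∧ x = f u)

/-- `(A, leA)` is an initial segment of `(B, leB)`: `A ⊆ B`, the orders agree on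
`A`, and `A` is downward closed in `B`. -/
def IsInitialSegmentOf (A : ZFSet) (leA : ZFSet → ZFSet → Prop)
    (B : ZFSet) (leB : ZFSet → ZFSet → Prop) : Prop :=
  A ⊆ B ∧ (∀ x ∈ A, ∀ y ∈ A, (leA x y ↔ leB x y)) ∧
    (∀ x ∈ A, ∀ y ∈ B, leB y x → y ∈ A)

/-- `leq_gen f x y` holds if there is a well-ordered set compatible with `f`
containing `x` and `y` with `x ≤ y` in it. -/
def leq_gen (f : ZFSet → ZFSet) (x y : ZFSet) : Prop :=
  ∃ (A : ZFSet) (le : ZFSet → ZFSet → Prop),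
    IsCompatible f A le ∧ x ∈ A ∧ y ∈ A ∧ le x y

/-- `x` lies in both `A` and `B`, and the orders of `A` and `B` restricted to the elements
below `x` coincide. -/
def IsCommonPoint (A : ZFSet) (leA : ZFSet → ZFSet → Prop)
    (B : ZFSet) (leB : ZFSet → ZFSet → Prop) (x : ZFSet) : Prop :=
  x ∈ A ∧ x ∈ B ∧ ∀ y z : ZFSet,
    (y ∈ A ∧ z ∈ A ∧ leA y z ∧ leA z x) ↔ (y ∈ B ∧ z ∈ B ∧ leB y z ∧ leB z x)

section

variable {f : ZFSet → ZFSet} {A B : ZFSet} {leA leB : ZFSet → ZFSet → Prop}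

theorem IsCommonPoint.symm {x : ZFSet} (h : IsCommonPoint A leA B leB x) :
    IsCommonPoint B leB A leA x :=
  ⟨h.2.1, h.1, fun y z => (h.2.2 y z).symm⟩

theorem isCommonPoint_comm {x : ZFSet} :
    IsCommonPoint A leA B leB x ↔ IsCommonPoint B leB A leA x :=
  ⟨.symm, .symm⟩

theorem IsCommonPoint.mem_and_le (hA : IsCompatible f A leA) {x y : ZFSet}
    (h : IsCommonPoint A leA B leB x) (hy : y ∈ A) (hyx : leA y x) : y ∈ B ∧ leB y x := by
  obtain ⟨hyB, -, -, hle⟩ := (h.2.2 y y).1 ⟨hy, hy, hA.1 y hy, hyx⟩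
  exact ⟨hyB, hle⟩

theorem IsCommonPoint.of_le (hA : IsCompatible f A leA) (hB : IsCompatible f B leB)
    {x w : ZFSet} (h : IsCommonPoint A leA B leB x) (hw : w ∈ A) (hwx : leA w x) :
    IsCommonPoint A leA B leB w := by
  obtain ⟨hwB, hwxB⟩ := h.mem_and_le hA hw hwx
  refine ⟨hw, hwB, fun y z => ⟨?_, ?_⟩⟩
  · rintro ⟨hy, hz, hyz, hzw⟩
    have hzx := hA.2.2.1 z hz w hw x h.1 hzw hwx
    obtain ⟨hyB, hzB, hyzB, -⟩ := (h.2.2 y z).1 ⟨hy, hz, hyz, hzx⟩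
    obtain ⟨-, -, hzwB, -⟩ := (h.2.2 z w).1 ⟨hz, hw, hzw, hwx⟩
    exact ⟨hyB, hzB, hyzB, hzwB⟩
  · rintro ⟨hy, hz, hyz, hzw⟩
    have hzx := hB.2.2.1 z hz w hwB x h.2.1 hzw hwxB
    obtain ⟨hyA, hzA, hyzA, -⟩ := (h.2.2 y z).2 ⟨hy, hz, hyz, hzx⟩
    obtain ⟨-, -, hzwA, -⟩ := (h.2.2 z w).2 ⟨hz, hwB, hzw, hwxB⟩
    exact ⟨hyA, hzA, hyzA, hzwA⟩

theorem isInitialSegmentOf_of_forall_isCommonPoint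
    (hA : IsCompatible f A leA) (hB : IsCompatible f B leB)
    (h : ∀ x ∈ A, IsCommonPoint A leA B leB x) : IsInitialSegmentOf A leA B leB :=
  ⟨fun x hx => (h x hx).2.1,
    fun x hx y hy => ⟨fun hxy => ((h y hy).mem_and_le hA hx hxy).2,
      fun hxy => ((h y hy).symm.mem_and_le hB (h x hx).2.1 hxy).2⟩,
    fun x hx _ hy hyx => ((h x hx).symm.mem_and_le hB hy hyx).1⟩

theorem IsCompatible.exists_least (hA : IsCompatible f A leA) {p : ZFSet → Prop}
    (h : ∃ x ∈ A, p x) : ∃ m ∈ A, p m ∧ ∀ y ∈ A, p y → leA m y := by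
  obtain ⟨x, hx, hpx⟩ := h
  obtain ⟨m, hm, hmin⟩ := hA.2.2.2.2.1 (ZFSet.sep p A)
    (fun y hy => (ZFSet.mem_sep.1 hy).1) ⟨x, ZFSet.mem_sep.2 ⟨hx, hpx⟩⟩
  exact ⟨m, (ZFSet.mem_sep.1 hm).1, (ZFSet.mem_sep.1 hm).2,
    fun y hy hpy => hmin y (ZFSet.mem_sep.2 ⟨hy, hpy⟩)⟩

/-- The strict predecessors of the least non-common point are exactly the common points. -/
theorem lt_least_iff_isCommonPoint
    (hA : IsCompatible f A leA) (hB : IsCompatible f B leB) {a : ZFSet} (ha : a ∈ A)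
    (hna : ¬ IsCommonPoint A leA B leB a)
    (hmin : ∀ y ∈ A, ¬ IsCommonPoint A leA B leB y → leA a y) (y : ZFSet) :
    (y ∈ A ∧ leA y a ∧ y ≠ a) ↔ IsCommonPoint A leA B leB y := by
  constructor
  · rintro ⟨hy, hya, hne⟩
    by_contra hc
    exact hne (hA.2.1 y hy a ha hya (hmin y hy hc))
  · intro hy
    refine ⟨hy.1, ?_, fun h => hna (h ▸ hy)⟩
    exact (hA.2.2.2.1 y hy.1 a ha).resolve_right fun h => hna (hy.of_le hA hB ha h)

theorem mem_and_le_of_lt_iff (hA : IsCompatible f A leA) (hB : IsCompatible f B leB) {a : ZFSet}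
    (haA : a ∈ A) (haB : a ∈ B)
    (hltA : ∀ y, (y ∈ A ∧ leA y a ∧ y ≠ a) ↔ IsCommonPoint A leA B leB y)
    (hltB : ∀ y, (y ∈ B ∧ leB y a ∧ y ≠ a) ↔ IsCommonPoint A leA B leB y) {y z : ZFSet}
    (h : y ∈ A ∧ z ∈ A ∧ leA y z ∧ leA z a) : y ∈ B ∧ z ∈ B ∧ leB y z ∧ leB z a := by
  obtain ⟨hy, hz, hyz, hza⟩ := h
  by_cases hzeq : z = a
  · subst hzeq
    by_cases hyeq : y = z
    · subst hyeq
      exact ⟨haB, haB, hB.1 y haB, hB.1 y haB⟩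
    · obtain ⟨hyB, hyzB, -⟩ := (hltB y).2 ((hltA y).1 ⟨hy, hyz, hyeq⟩)
      exact ⟨hyB, haB, hyzB, hB.1 z haB⟩
  · have hc := (hltA z).1 ⟨hz, hza, hzeq⟩
    obtain ⟨hzB, hzaB, -⟩ := (hltB z).2 hc
    obtain ⟨hyB, hyzB⟩ := hc.mem_and_le hA hy hyz
    exact ⟨hyB, hzB, hyzB, hzaB⟩

theorem IsCompatible.isInitialSegmentOf_or
    (hA : IsCompatible f A leA) (hB : IsCompatible f B leB) :
    IsInitialSegmentOf A leA B leB ∨ IsInitialSegmentOf B leB A leA := by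
  by_cases hAc : ∀ x ∈ A, IsCommonPoint A leA B leB x
  · exact .inl (isInitialSegmentOf_of_forall_isCommonPoint hA hB hAc)
  by_cases hBc : ∀ x ∈ B, IsCommonPoint B leB A leA x
  · exact .inr (isInitialSegmentOf_of_forall_isCommonPoint hB hA hBc)
  exfalso
  push Not at hAc hBc
  obtain ⟨a, ha, hna, hamin⟩ := hA.exists_least hAc
  obtain ⟨b, hb, hnb, hbmin⟩ := hB.exists_least hBc
  have hltA := lt_least_iff_isCommonPoint hA hB ha hna hamin
  have hltB : ∀ y, (y ∈ B ∧ leB y b ∧ y ≠ b) ↔ IsCommonPoint A leA B leB y := fun y =>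
    (lt_least_iff_isCommonPoint hB hA hb hnb hbmin y).trans isCommonPoint_comm
  obtain ⟨u, hu, hau⟩ := hA.2.2.2.2.2 a ha
  obtain ⟨v, hv, hbv⟩ := hB.2.2.2.2.2 b hb
  have huv : u = v := ZFSet.ext fun y =>
    (hu y).trans ((hltA y).trans ((hltB y).symm.trans (hv y).symm))
  obtain rfl : a = b := by rw [hau, hbv, huv]
  exact hna ⟨ha, hb, fun y z => ⟨mem_and_le_of_lt_iff hA hB ha hb hltA hltB,
    mem_and_le_of_lt_iff hB hA hb ha (fun y => (hltB y).trans isCommonPoint_comm)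
      (fun y => (hltA y).trans isCommonPoint_comm)⟩⟩

/-- A compatible well-ordered set is downward closed for `leq_gen f`, which restricts to its
order. -/
theorem IsCompatible.mem_and_le_of_leq_gen (hA : IsCompatible f A leA) {x y : ZFSet}
    (hy : y ∈ A) (h : leq_gen f x y) : x ∈ A ∧ leA x y := by
  obtain ⟨B, leB, hB, hxB, hyB, hxy⟩ := h
  obtain ⟨-, hiff, hdown⟩ | ⟨hsub, hiff, -⟩ := hA.isInitialSegmentOf_or hB
  · have hxA := hdown y hy x hxB hxy
    exact ⟨hxA, (hiff x hxA y hy).2 hxy⟩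
  · exact ⟨hsub hxB, (hiff x hxB y hyB).1 hxy⟩

end

/-- Transfinite recursion: for any operation `f` on sets, any two well-ordered sets
compatible with `f` compare as initial segments of one another (so the elements of a
compatible well-ordered set are uniquely determined by their position), and the
relation `leq_gen f`, the union of the orders of all compatible well-ordered sets,
is a well-founded partial order (antisymmetric and transitive, with well-founded
strict part). -/
theorem transfinite_recursion (f : ZFSet → ZFSet) :
    (∀ (A : ZFSet) (leA : ZFSet → ZFSet → Prop) (B : ZFSet)
        (leB : ZFSet → ZFSet → Prop),
      IsCompatible f A leA → IsCompatible f B leB →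
        IsInitialSegmentOf A leA B leB ∨ IsInitialSegmentOf B leB A leA) ∧
    (∀ x y : ZFSet, leq_gen f x y → leq_gen f y x → x = y) ∧
    (∀ x y z : ZFSet, leq_gen f x y → leq_gen f y z → leq_gen f x z) ∧
    WellFounded (fun x y : ZFSet => leq_gen f x y ∧ x ≠ y) := by
  refine ⟨fun A leA B leB hA hB => hA.isInitialSegmentOf_or hB, ?_, ?_, ?_⟩
  · rintro x y ⟨A, le, hA, hx, hy, hxy⟩ hyx
    exact hA.2.1 x hx y hy hxy (hA.mem_and_le_of_leq_gen hx hyx).2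
  · rintro x y z hxy ⟨A, le, hA, hy, hz, hyz⟩
    obtain ⟨hx, hxy⟩ := hA.mem_and_le_of_leq_gen hy hxy
    exact ⟨A, le, hA, hx, hz, hA.2.2.1 x hx y hy z hz hxy hyz⟩
  · refine WellFounded.wellFounded_iff_has_min.2 fun S ⟨x, hxS⟩ => ?_
    by_cases hx : ∃ A le, IsCompatible f A le ∧ x ∈ A
    · obtain ⟨A, le, hA, hxA⟩ := hx
      obtain ⟨m, hm, hmS, hmin⟩ := hA.exists_least (p := (· ∈ S)) ⟨x, hxA, hxS⟩
      refine ⟨m, hmS, fun y hyS ⟨hym, hne⟩ => hne ?_⟩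
      obtain ⟨hy, hym⟩ := hA.mem_and_le_of_leq_gen hm hym
      exact hA.2.1 y hy m hm hym (hmin y hy hyS)
    · refine ⟨x, hxS, ?_⟩
      rintro y - ⟨⟨A, le, hA, -, hxA, -⟩, -⟩
      exact hx ⟨A, le, hA, hxA⟩
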